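/- If a labelled open graph (G, I, O, λ) has a Pauli flow, then it has a Pauli flow (p, ≺) satisfying: for every v ∈ V∖O with λ(v) ∈ {X, Y, Z} and every u ∈ V, ¬(u ≺ v) holds (i.e., every Pauli-labelled vertex is ≺-maximal, so it may be measured first). -/

import Mathlib

open scoped symmDiff

inductive MeasLabel : Type
  | XY | XZ | YZ | X | Y | Z
deriving DecidableEq

/-- A labelled open graph: a finite simple graph with input and output sets and a
measurement labelling (only its values on non-outputs are ever used). -/
structure LOG (V : Type) [Fintype V] where
  G : SimpleGraph V
  I : Set V
  O : Set V
  lam : V → MeasLabel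

namespace LOG

variable {V : Type} [Fintype V]

/-- The odd neighbourhood of `A`: vertices with an odd number of neighbours in `A`. -/
def odd (G : SimpleGraph V) (A : Set V) : Set V :=
  {w | Odd ((G.neighborSet w ∩ A).ncard)}

/-- `v` is a measured (non-output) vertex whose label lies in `s`.  (The labelling of a
labelled open graph is only defined on non-outputs.) -/
def labIn (Γ : LOG V) (v : V) (s : Set MeasLabel) : Prop :=
  v ∉ Γ.O ∧ Γ.lam v ∈ s

/-- The Pauli flow conditions for a map `p` and a strict partial order `prec` (`≺`). -/
structure IsPauliFlow (Γ : LOG V) (p : V → Set V) (prec : V → V → Prop) : Prop where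
  irrefl : ∀ a, ¬ prec a a
  trans : ∀ a b c, prec a b → prec b c → prec a c
  psub : ∀ u, u ∉ Γ.O → ∀ v ∈ p u, v ∉ Γ.I
  pf1 : ∀ u, u ∉ Γ.O → ∀ v ∈ p u, u ≠ v →
    ¬ Γ.labIn v {MeasLabel.X, MeasLabel.Y} → prec u v
  pf2 : ∀ u, u ∉ Γ.O → ∀ v ∈ odd Γ.G (p u), u ≠ v →
    ¬ Γ.labIn v {MeasLabel.Y, MeasLabel.Z} → prec u v
  pf3 : ∀ u, u ∉ Γ.O → ∀ v, ¬ prec u v → u ≠ v →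
    Γ.labIn v {MeasLabel.Y} → (v ∈ p u ↔ v ∈ odd Γ.G (p u))
  pf4 : ∀ u, u ∉ Γ.O → Γ.lam u = MeasLabel.XY → u ∉ p u ∧ u ∈ odd Γ.G (p u)
  pf5 : ∀ u, u ∉ Γ.O → Γ.lam u = MeasLabel.XZ → u ∈ p u ∧ u ∈ odd Γ.G (p u)
  pf6 : ∀ u, u ∉ Γ.O → Γ.lam u = MeasLabel.YZ → u ∈ p u ∧ u ∉ odd Γ.G (p u)
  pf7 : ∀ u, u ∉ Γ.O → Γ.lam u = MeasLabel.X → u ∈ odd Γ.G (p u)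
  pf8 : ∀ u, u ∉ Γ.O → Γ.lam u = MeasLabel.Z → u ∈ p u
  pf9 : ∀ u, u ∉ Γ.O → Γ.lam u = MeasLabel.Y →
    ((u ∈ p u ∧ u ∉ odd Γ.G (p u)) ∨ (u ∉ p u ∧ u ∈ odd Γ.G (p u)))

/-- `phat` is focussed over `S`. -/
def FocussedOver (Γ : LOG V) (phat S : Set V) : Prop :=
  (∀ w ∈ S ∩ phat, Γ.lam w ∈ ({MeasLabel.XY, MeasLabel.X, MeasLabel.Y} : Set MeasLabel)) ∧
  (∀ w ∈ S ∩ odd Γ.G phat,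
    Γ.lam w ∈ ({MeasLabel.XZ, MeasLabel.YZ, MeasLabel.Y, MeasLabel.Z} : Set MeasLabel)) ∧
  (∀ w ∈ S, Γ.lam w = MeasLabel.Y → (w ∈ phat ↔ w ∈ odd Γ.G phat))

/-- A focussed set for `Γ`: a subset of the non-inputs that is focussed over all
non-outputs. -/
def IsFocussedSet (Γ : LOG V) (phat : Set V) : Prop :=
  (∀ v ∈ phat, v ∉ Γ.I) ∧ FocussedOver Γ phat {v | v ∉ Γ.O}

/-- A Pauli flow map `p` is focussed if each `p v` is focussed over the measured
vertices other than `v`. -/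
def IsFocussed (Γ : LOG V) (p : V → Set V) : Prop :=
  ∀ v, v ∉ Γ.O → FocussedOver Γ (p v) ({w | w ∉ Γ.O} \ {v})

/-- `Vcum prec k` is `V_{∪k}^≺`, the union of the layers up to depth `k`. -/
def Vcum (prec : V → V → Prop) : ℕ → Set V
  | 0 => {v | ∀ w, ¬ prec v w}
  | k + 1 => Vcum prec k ∪ {v | v ∉ Vcum prec k ∧ ∀ w, w ∉ Vcum prec k → ¬ prec v w}

/-- `Vlayer prec k` is `V_k^≺`, the `≺`-maximal elements among the vertices not of
smaller depth. -/
def Vlayer (prec : V → V → Prop) : ℕ → Set V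
  | 0 => {v | ∀ w, ¬ prec v w}
  | k + 1 => {v | v ∉ Vcum prec k ∧ ∀ w, w ∉ Vcum prec k → ¬ prec v w}

/-- `prec` is more delayed than `prec'`. -/
def MoreDelayed (prec prec' : V → V → Prop) : Prop :=
  (∀ k, (Vcum prec' k).ncard ≤ (Vcum prec k).ncard) ∧
  ∃ k, (Vcum prec' k).ncard < (Vcum prec k).ncard

/-- A maximally delayed Pauli flow: no Pauli flow for the same labelled open graph is
more delayed. -/
def IsMaxDelayed (Γ : LOG V) (p : V → Set V) (prec : V → V → Prop) : Prop :=
  IsPauliFlow Γ p prec ∧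
  ∀ q prec', IsPauliFlow Γ q prec' → ¬ MoreDelayed prec' prec

/-- `Λ_u^P`: the measured vertices other than `u` whose label is `P`. -/
def LamP (Γ : LOG V) (u : V) (P : MeasLabel) : Set V :=
  {v | v ∉ Γ.O ∧ v ≠ u ∧ Γ.lam v = P}

/-- `V_{k+1}^{≺,XY}` where `A = V_{∪k}^≺`. -/
def VXY (Γ : LOG V) (A : Set V) : Set V :=
  {u | u ∉ Γ.O ∧ Γ.lam u ∈ ({MeasLabel.XY, MeasLabel.X, MeasLabel.Y} : Set MeasLabel) ∧
    ∃ K, K ⊆ (A ∪ LamP Γ u MeasLabel.X ∪ LamP Γ u MeasLabel.Y) ∩ {v | v ∉ Γ.I} ∧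
      (K ∩ LamP Γ u MeasLabel.Y) \ A = (odd Γ.G K ∩ LamP Γ u MeasLabel.Y) \ A ∧
      odd Γ.G K \ (A ∪ LamP Γ u MeasLabel.Y ∪ LamP Γ u MeasLabel.Z) = {u}}

/-- `V_{k+1}^{≺,XZ}` where `A = V_{∪k}^≺`. -/
def VXZ (Γ : LOG V) (A : Set V) : Set V :=
  {u | u ∉ Γ.O ∧ Γ.lam u ∈ ({MeasLabel.XZ, MeasLabel.X, MeasLabel.Z} : Set MeasLabel) ∧
    ∃ K, K ⊆ (A ∪ LamP Γ u MeasLabel.X ∪ LamP Γ u MeasLabel.Y) ∩ {v | v ∉ Γ.I} ∧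
      (K ∩ LamP Γ u MeasLabel.Y) \ A = (odd Γ.G (K ∪ {u}) ∩ LamP Γ u MeasLabel.Y) \ A ∧
      odd Γ.G (K ∪ {u}) \ (A ∪ LamP Γ u MeasLabel.Y ∪ LamP Γ u MeasLabel.Z) = {u}}

/-- `V_{k+1}^{≺,YZ}` where `A = V_{∪k}^≺`. -/
def VYZ (Γ : LOG V) (A : Set V) : Set V :=
  {u | u ∉ Γ.O ∧ Γ.lam u ∈ ({MeasLabel.YZ, MeasLabel.Y, MeasLabel.Z} : Set MeasLabel) ∧
    ∃ K, K ⊆ (A ∪ LamP Γ u MeasLabel.X ∪ LamP Γ u MeasLabel.Y) ∩ {v | v ∉ Γ.I} ∧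
      (K ∩ LamP Γ u MeasLabel.Y) \ A = (odd Γ.G (K ∪ {u}) ∩ LamP Γ u MeasLabel.Y) \ A ∧
      odd Γ.G (K ∪ {u}) \ (A ∪ LamP Γ u MeasLabel.Y ∪ LamP Γ u MeasLabel.Z) = ∅}

end LOG



namespace LOG

theorem mem_odd_symmDiff {V : Type} [Fintype V] (G : SimpleGraph V) (A B : Set V) (w : V) :
    w ∈ odd G (A ∆ B) ↔ ¬ (w ∈ odd G A ↔ w ∈ odd G B) := by
  have hA := Set.ncard_inter_add_ncard_diff_eq_ncard (G.neighborSet w ∩ A)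
    (G.neighborSet w ∩ B) (Set.toFinite _)
  have hB := Set.ncard_inter_add_ncard_diff_eq_ncard (G.neighborSet w ∩ B)
    (G.neighborSet w ∩ A) (Set.toFinite _)
  rw [Set.inter_comm (G.neighborSet w ∩ B)] at hB
  have hU : G.neighborSet w ∩ (A ∆ B) =
      ((G.neighborSet w ∩ A) \ (G.neighborSet w ∩ B)) ∪
      ((G.neighborSet w ∩ B) \ (G.neighborSet w ∩ A)) := by
    ext x
    simp only [Set.mem_inter_iff, Set.mem_symmDiff, Set.mem_union, Set.mem_diff]
    tauto
  have hd : Disjoint ((G.neighborSet w ∩ A) \ (G.neighborSet w ∩ B))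
      ((G.neighborSet w ∩ B) \ (G.neighborSet w ∩ A)) := by
    rw [Set.disjoint_left]
    rintro x hx hy
    exact hx.2 hy.1
  have hc := Set.ncard_union_eq hd (Set.toFinite _) (Set.toFinite _)
  rw [← hU] at hc
  simp only [odd, Set.mem_setOf_eq, Nat.odd_iff]
  omega

/-- Measured vertices with a Pauli label. -/
def IsPauli {V : Type} [Fintype V] (Γ : LOG V) (v : V) : Prop :=
  v ∉ Γ.O ∧ (Γ.lam v = MeasLabel.X ∨ Γ.lam v = MeasLabel.Y ∨ Γ.lam v = MeasLabel.Z)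

/-- The correction set `A` flips the outcome at the Pauli vertex `v`. -/
def Err {V : Type} [Fintype V] (Γ : LOG V) (v : V) (A : Set V) : Prop :=
  IsPauli Γ v ∧ ((Γ.lam v = MeasLabel.X ∧ v ∈ odd Γ.G A) ∨ (Γ.lam v = MeasLabel.Z ∧ v ∈ A) ∨
    (Γ.lam v = MeasLabel.Y ∧ ¬ (v ∈ A ↔ v ∈ odd Γ.G A)))

theorem err_symmDiff {V : Type} [Fintype V] (Γ : LOG V) (v : V) (A B : Set V) :
    Err Γ v (A ∆ B) ↔ ¬ (Err Γ v A ↔ Err Γ v B) := by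
  unfold Err
  rw [mem_odd_symmDiff, Set.mem_symmDiff]
  by_cases hP : IsPauli Γ v
  · rcases hP.2 with h | h | h <;> simp [hP, h] <;> tauto
  · simp [hP]

/-- Invariant of the focussing procedure. -/
structure Inv {V : Type} [Fintype V] (Γ : LOG V) (p : V → Set V) (prec : V → V → Prop)
    (u : V) (A : Set V) : Prop where
  sub : ∀ v ∈ A, v ∉ Γ.I
  np : ∀ v, v ≠ u → ¬ IsPauli Γ v → (v ∈ A ∨ v ∈ odd Γ.G A) → prec u v
  pa : ∀ v, v ≠ u → Err Γ v A → prec u v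
  selfP : IsPauli Γ u → Err Γ u A
  selfN : ¬ IsPauli Γ u → (u ∈ A ↔ u ∈ p u) ∧ (u ∈ odd Γ.G A ↔ u ∈ odd Γ.G (p u))

theorem inv_start {V : Type} [Fintype V] {Γ : LOG V} {p : V → Set V} {prec : V → V → Prop}
    (h : IsPauliFlow Γ p prec) (u : V) (hu : u ∉ Γ.O) : Inv Γ p prec u (p u) where
  sub := h.psub u hu
  np := by
    rintro v hv hP (hA | hA)
    · refine h.pf1 u hu v hA hv.symm fun hl => hP ⟨hl.1, ?_⟩
      have := hl.2
      simp at this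
      tauto
    · refine h.pf2 u hu v hA hv.symm fun hl => hP ⟨hl.1, ?_⟩
      have := hl.2
      simp at this
      tauto
  pa := by
    rintro v hv ⟨hP, ⟨hl, hA⟩ | ⟨hl, hA⟩ | ⟨hl, hA⟩⟩
    · exact h.pf2 u hu v hA hv.symm (by simp [labIn, hl])
    · exact h.pf1 u hu v hA hv.symm (by simp [labIn, hl])
    · by_contra hn
      exact hA (h.pf3 u hu v hn hv.symm ⟨hP.1, by simp [hl]⟩)
  selfP := by
    intro hP
    refine ⟨hP, ?_⟩
    rcases hP.2 with hl | hl | hl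
    · exact Or.inl ⟨hl, h.pf7 u hu hl⟩
    · have := h.pf9 u hu hl
      exact Or.inr (Or.inr ⟨hl, by tauto⟩)
    · exact Or.inr (Or.inl ⟨hl, h.pf8 u hu hl⟩)
  selfN := fun _ => ⟨Iff.rfl, Iff.rfl⟩

theorem inv_step {V : Type} [Fintype V] {Γ : LOG V} {p : V → Set V} {prec : V → V → Prop}
    (h : IsPauliFlow Γ p prec) {u v : V} {A B : Set V} (huv : prec u v)
    (hA : Inv Γ p prec u A) (hB : Inv Γ p prec v B) (hBe : ∀ w, w ≠ v → ¬ Err Γ w B) :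
    Inv Γ p prec u (A ∆ B) := by
  have huv' : u ≠ v := fun e => h.irrefl v (e ▸ huv)
  refine ⟨?_, ?_, ?_, ?_, ?_⟩
  · intro w hw
    rcases hw with hw | hw
    · exact hA.sub w hw.1
    · exact hB.sub w hw.1
  · intro w hwu hP hw
    rw [mem_odd_symmDiff, Set.mem_symmDiff] at hw
    by_cases hwA : w ∈ A ∨ w ∈ odd Γ.G A
    · exact hA.np w hwu hP hwA
    · have hwB : w ∈ B ∨ w ∈ odd Γ.G B := by tauto
      by_cases hwv : w = v
      · exact hwv ▸ huv
      · exact h.trans _ _ _ huv (hB.np w hwv hP hwB)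
  · intro w hwu hw
    by_cases hwv : w = v
    · exact hwv ▸ huv
    · have := hBe w hwv
      rw [err_symmDiff] at hw
      exact hA.pa w hwu (by tauto)
  · intro hP
    have := hBe u huv'
    have := hA.selfP hP
    rw [err_symmDiff]
    tauto
  · intro hP
    have hn : ¬ (u ∈ B ∨ u ∈ odd Γ.G B) := fun hb =>
      h.irrefl _ (h.trans _ _ _ huv (hB.np u huv' hP hb))
    have := hA.selfN hP
    rw [mem_odd_symmDiff, Set.mem_symmDiff]
    tauto

theorem inv_reduce {V : Type} [Fintype V] {Γ : LOG V} {p : V → Set V} {prec : V → V → Prop}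
    (h : IsPauliFlow Γ p prec) (u : V)
    (ih : ∀ v, prec u v → v ∉ Γ.O → ∃ B, Inv Γ p prec v B ∧ ∀ w, w ≠ v → ¬ Err Γ w B) :
    ∀ (n : ℕ) (A : Set V), {w | w ≠ u ∧ Err Γ w A}.ncard = n → Inv Γ p prec u A →
      ∃ B, Inv Γ p prec u B ∧ ∀ w, w ≠ u → ¬ Err Γ w B := by
  intro n
  induction n using Nat.strong_induction_on with
  | _ n IH =>
    intro A hn hA
    by_cases hex : ∃ v, v ≠ u ∧ Err Γ v A
    · obtain ⟨v, hvu, hve⟩ := hex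
      have huv := hA.pa v hvu hve
      obtain ⟨B, hB, hBe⟩ := ih v huv hve.1.1
      refine IH _ ?_ (A ∆ B) rfl (inv_step h huv hA hB hBe)
      rw [← hn]
      apply Set.ncard_lt_ncard _ (Set.toFinite _)
      refine ⟨?_, fun hs => ?_⟩
      · rintro w ⟨hwu, hw⟩
        refine ⟨hwu, ?_⟩
        by_cases hwv : w = v
        · exact hwv ▸ hve
        · have := hBe w hwv
          rw [err_symmDiff] at hw
          tauto
      · have h1 := (hs ⟨hvu, hve⟩).2
        have h2 := hB.selfP hve.1
        rw [err_symmDiff] at h1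
        tauto
    · exact ⟨A, hA, fun w hw he => hex ⟨w, hw, he⟩⟩

theorem exists_focussed {V : Type} [Fintype V] {Γ : LOG V} {p : V → Set V}
    {prec : V → V → Prop} (h : IsPauliFlow Γ p prec) (u : V) :
    u ∉ Γ.O → ∃ B, Inv Γ p prec u B ∧ ∀ w, w ≠ u → ¬ Err Γ w B := by
  have : IsTrans V (flip prec) := ⟨fun a b c hab hbc => h.trans c b a hbc hab⟩
  have : Std.Irrefl (flip prec) := ⟨fun a => h.irrefl a⟩
  have wf : WellFounded (flip prec) := Finite.wellFounded_of_trans_of_irrefl _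
  induction u using wf.induction with
  | _ u ih =>
    intro hu
    exact inv_reduce h u (fun v hv => ih v hv) _ (p u) rfl (inv_start h u hu)

end LOG

open LOG in
/-- a labelled open graph with a Pauli flow has a Pauli flow in which
every Pauli-labelled measured vertex is `≺`-maximal. -/
theorem exists_pauliFlow_pauli_first {V : Type} [Fintype V] (Γ : LOG V)
    (h : ∃ p prec, IsPauliFlow Γ p prec) :
    ∃ p prec, IsPauliFlow Γ p prec ∧
      ∀ v, v ∉ Γ.O →
        Γ.lam v ∈ ({MeasLabel.X, MeasLabel.Y, MeasLabel.Z} : Set MeasLabel) →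
        ∀ u, ¬ prec u v := by
  obtain ⟨p, prec, h⟩ := h
  have hex : ∀ u, ∃ B, u ∉ Γ.O → Inv Γ p prec u B ∧ ∀ w, w ≠ u → ¬ Err Γ w B := by
    intro u
    by_cases hu : u ∈ Γ.O
    · exact ⟨∅, fun hn => absurd hu hn⟩
    · obtain ⟨B, hB⟩ := exists_focussed h u hu
      exact ⟨B, fun _ => hB⟩
  choose q hq using hex
  refine ⟨q, fun a b => prec a b ∧ ¬ IsPauli Γ b, ?_, ?_⟩
  · have nonP : ∀ u, (Γ.lam u = MeasLabel.XY ∨ Γ.lam u = MeasLabel.XZ ∨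
        Γ.lam u = MeasLabel.YZ) → ¬ IsPauli Γ u := by
      rintro u (hl | hl | hl) hP <;> simpa [hl] using hP.2
    refine ⟨fun a ha => h.irrefl a ha.1,
      fun a b c hab hbc => ⟨h.trans _ _ _ hab.1 hbc.1, hbc.2⟩,
      fun u hu => (hq u hu).1.sub, ?_, ?_, ?_, ?_, ?_, ?_, ?_, ?_, ?_⟩
    · intro u hu v hv huv hl
      have hP : ¬ IsPauli Γ v := by
        intro hP
        refine (hq u hu).2 v huv.symm ⟨hP, ?_⟩
        rcases hP.2 with h1 | h1 | h1
        · exact absurd ⟨hP.1, by simp [h1]⟩ hl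
        · exact absurd ⟨hP.1, by simp [h1]⟩ hl
        · exact Or.inr (Or.inl ⟨h1, hv⟩)
      exact ⟨(hq u hu).1.np v huv.symm hP (Or.inl hv), hP⟩
    · intro u hu v hv huv hl
      have hP : ¬ IsPauli Γ v := by
        intro hP
        refine (hq u hu).2 v huv.symm ⟨hP, ?_⟩
        rcases hP.2 with h1 | h1 | h1
        · exact Or.inl ⟨h1, hv⟩
        · exact absurd ⟨hP.1, by simp [h1]⟩ hl
        · exact absurd ⟨hP.1, by simp [h1]⟩ hl
      exact ⟨(hq u hu).1.np v huv.symm hP (Or.inr hv), hP⟩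
    · intro u hu v _ huv hl
      by_contra hn
      have hY : Γ.lam v = MeasLabel.Y := hl.2
      exact (hq u hu).2 v huv.symm ⟨⟨hl.1, by simp [hY]⟩, Or.inr (Or.inr ⟨hY, hn⟩)⟩
    · intro u hu hl
      have h1 := (hq u hu).1.selfN (nonP u (by simp [hl]))
      rw [h1.1, h1.2]
      exact h.pf4 u hu hl
    · intro u hu hl
      have h1 := (hq u hu).1.selfN (nonP u (by simp [hl]))
      rw [h1.1, h1.2]
      exact h.pf5 u hu hl
    · intro u hu hl
      have h1 := (hq u hu).1.selfN (nonP u (by simp [hl]))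
      rw [h1.1, h1.2]
      exact h.pf6 u hu hl
    · intro u hu hl
      have h1 := ((hq u hu).1.selfP ⟨hu, by simp [hl]⟩).2
      simpa [hl] using h1
    · intro u hu hl
      have h1 := ((hq u hu).1.selfP ⟨hu, by simp [hl]⟩).2
      simpa [hl] using h1
    · intro u hu hl
      have h1 := ((hq u hu).1.selfP ⟨hu, by simp [hl]⟩).2
      have h2 : ¬ (u ∈ q u ↔ u ∈ odd Γ.G (q u)) := by
        rcases h1 with h1 | h1 | h1
        · exact absurd (hl.symm.trans h1.1) (by simp)
        · exact absurd (hl.symm.trans h1.1) (by simp)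
        · exact h1.2
      tauto
  · intro v hv hl u hu
    refine hu.2 ⟨hv, ?_⟩
    simpa using hl
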